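/- arXiv:2102.11253 — 2 statements merged into one kernel-verified Lean document; each statement's English description precedes it below -/
import Mathlib

section
/- Let m ≥ 1, r ≥ 1, and let Σ be an m×m real positive semidefinite matrix with unit diagonal such that 1ᵀΣ1 > 0, where 1 is the all-ones vector. Let X = (X_1,…,X_m) be a centered multivariate Gaussian vector with covariance Σ and set σ_Σ = √(1ᵀΣ1)/m. Then for every C with 0 < C < (2m)^{−r}, Pr( (1/m) Σ_{i=1}^m Φ(−X_i)^r ≤ C ) ≤ 1 − Φ( −Φ^{−1}(C^{1/r}) / σ_Σ ), where Φ^{−1} is the standard normal quantile function (note −Φ^{−1}(C^{1/r}) > 0 here since C^{1/r} < 1/2). -/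
open MeasureTheory ProbabilityTheory

/-- Standard normal CDF `Φ`. -/
noncomputable def Phi (x : ℝ) : ℝ := ((gaussianReal 0 1 : Measure ℝ) (Set.Iic x)).toReal

/-- Standard normal quantile function `Φ⁻¹` (a two-sided inverse of `Φ` on `(0,1)`). -/
noncomputable def PhiInv (y : ℝ) : ℝ := Function.invFun Phi y

/-- Law of a centered Gaussian vector `X = A Z` with `Z` i.i.d. standard normal,
so that `X` has covariance `A Aᵀ`. -/
noncomputable def gaussianVec (m : ℕ) (A : Matrix (Fin m) (Fin m) ℝ) :
    Measure (Fin m → ℝ) :=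
  (Measure.pi fun _ : Fin m => (gaussianReal 0 1 : Measure ℝ)).map A.mulVec

lemma Phi_eq_integral (x : ℝ) : Phi x = ∫ y in Set.Iic x, gaussianPDFReal 0 1 y := by
  rw [Phi, gaussianReal_apply_eq_integral 0 one_ne_zero, ENNReal.toReal_ofReal]
  exact integral_nonneg fun y => gaussianPDFReal_nonneg _ _ _

lemma continuous_gaussianPDFReal (μ : ℝ) (v : NNReal) : Continuous (gaussianPDFReal μ v) := by
  unfold gaussianPDFReal
  fun_prop

lemma hasDerivAt_Phi (x : ℝ) : HasDerivAt Phi (gaussianPDFReal 0 1 x) x := by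
  have h : Phi = fun u => (∫ y in (0 : ℝ)..u, gaussianPDFReal 0 1 y) + Phi 0 := by
    funext u
    rw [Phi_eq_integral, Phi_eq_integral, ← intervalIntegral.integral_Iic_sub_Iic
      (integrable_gaussianPDFReal 0 1).integrableOn (integrable_gaussianPDFReal 0 1).integrableOn]
    ring
  rw [h]
  exact ((continuous_gaussianPDFReal 0 1).integral_hasStrictDerivAt 0 x).hasDerivAt.add_const _

lemma continuous_Phi : Continuous Phi :=
  continuous_iff_continuousAt.2 fun x => (hasDerivAt_Phi x).continuousAt

lemma strictMono_Phi : StrictMono Phi :=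
  strictMono_of_deriv_pos fun x => by
    rw [(hasDerivAt_Phi x).deriv]
    exact gaussianPDFReal_pos 0 1 x one_ne_zero

lemma Phi_nonneg (x : ℝ) : 0 ≤ Phi x := ENNReal.toReal_nonneg

lemma convexOn_Phi : ConvexOn ℝ (Set.Iic 0) Phi := by
  refine MonotoneOn.convexOn_of_deriv (convex_Iic 0) continuous_Phi.continuousOn
    (fun x _ => (hasDerivAt_Phi x).differentiableAt.differentiableWithinAt) ?_
  rw [interior_Iic]
  intro x hx y hy hxy
  rw [(hasDerivAt_Phi x).deriv, (hasDerivAt_Phi y).deriv]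
  simp only [Set.mem_Iio] at hx hy
  simp only [gaussianPDFReal]
  gcongr ?_ * Real.exp (-?_ / _)
  simp only [sub_zero]
  nlinarith

lemma convexOn_Phi_rpow {r : ℝ} (hr : 1 ≤ r) :
    ConvexOn ℝ (Set.Iic 0) fun x => Phi x ^ r := by
  refine ⟨convex_Iic 0, fun x hx y hy a b ha hb hab => ?_⟩
  have h := (convexOn_rpow hr).2 (Phi_nonneg x) (Phi_nonneg y) ha hb hab
  exact (Real.rpow_le_rpow (Phi_nonneg _) (convexOn_Phi.2 hx hy ha hb hab) (by linarith)).trans h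

lemma one_sub_Phi (x : ℝ) : 1 - Phi x = (gaussianReal 0 1).real (Set.Ici x) := by
  have := nullSingletonClass_gaussianReal (μ := 0) (one_ne_zero (α := NNReal))
  rw [← measureReal_congr (Ioi_ae_eq_Ici (μ := gaussianReal 0 1)), ← Set.compl_Iic,
    probReal_compl_eq_one_sub measurableSet_Iic]
  rfl

lemma Phi_zero : Phi 0 = 1 / 2 := by
  have h : 1 - Phi 0 = Phi 0 := by
    rw [one_sub_Phi]
    have := gaussianReal_map_neg (μ := 0) (v := 1)
    rw [neg_zero] at this
    conv_lhs => rw [← this]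
    rw [map_measureReal_apply measurable_neg measurableSet_Ici]
    simp [Phi, Measure.real]
  linarith

lemma Phi_PhiInv {y : ℝ} (hy0 : 0 < y) (hy : y ≤ 1 / 2) : Phi (PhiInv y) = y := by
  refine Function.invFun_eq ?_
  have hlim : Filter.Tendsto Phi Filter.atBot (nhds 0) := by
    refine (tendsto_cdf_atBot (gaussianReal 0 1)).congr fun x => ?_
    rw [cdf_eq_real]
    rfl
  obtain ⟨a, ha, ha0⟩ :=
    ((hlim.eventually (gt_mem_nhds hy0)).and (Filter.eventually_le_atBot 0)).exists
  obtain ⟨x, -, hx⟩ := intermediate_value_Icc ha0 continuous_Phi.continuousOn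
    ⟨ha.le, hy.trans_eq Phi_zero.symm⟩
  exact ⟨x, hx⟩

/-- A linear combination of independent standard normals is a centered normal. -/
lemma map_sum_mul_pi_gaussianReal {ι : Type*} [Fintype ι] (w : ι → ℝ) :
    (Measure.pi fun _ : ι => gaussianReal 0 1).map (fun z => ∑ i, w i * z i) =
      gaussianReal 0 (∑ i, w i ^ 2).toNNReal := by
  classical
  have h1 : (fun z : ι → ℝ => ∑ i, w i * z i) =
      (fun p : ι → ℝ => ∑ i, p i) ∘ fun z i => w i * z i := rfl
  rw [h1, ← Measure.map_map (by fun_prop) (by fun_prop),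
    Measure.pi_map_pi (f := fun i x => w i * x) (fun i => by fun_prop)]
  simp_rw [gaussianReal_map_const_mul]
  refine Measure.ext_of_charFun ?_
  rw [charFun_map_sum_pi_eq_prod]
  funext t
  have hs : 0 ≤ ∑ i, w i ^ 2 := Finset.sum_nonneg fun i _ => sq_nonneg _
  simp only [Finset.prod_apply, charFun_gaussianReal, ← Complex.exp_sum,
    Real.coe_toNNReal _ hs]
  congr 1
  simp [Finset.sum_mul, Finset.sum_div]

/-- Upper tail of a centered normal with standard deviation `s`. -/
lemma gaussianReal_Ici_eq {s : ℝ} (hs : 0 < s) (t : ℝ) :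
    gaussianReal 0 (s ^ 2).toNNReal (Set.Ici t) = ENNReal.ofReal (1 - Phi (t / s)) := by
  have h := gaussianReal_map_const_mul (μ := 0) (v := 1) s
  have hv : (.mk (s ^ 2) (sq_nonneg s) * 1 : NNReal) = (s ^ 2).toNNReal := by
    ext
    simp [sq_nonneg]
  rw [mul_zero, hv] at h
  rw [← h, Measure.map_apply (by fun_prop) measurableSet_Ici, one_sub_Phi, ofReal_measureReal]
  congr 1
  ext x
  simp [div_le_iff₀ hs, mul_comm]

/-- for `r ≥ 1`, a PSD unit-diagonal `Σ` with `1ᵀΣ1 > 0`,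
`σ_Σ = √(1ᵀΣ1)/m` and `0 < C < (2m)^{-r}`,
`Pr((1/m) Σ_i Φ(-X_i)^r ≤ C) ≤ 1 - Φ(-Φ⁻¹(C^{1/r})/σ_Σ)`. -/
theorem stmt_8 (m : ℕ) (hm : 1 ≤ m) (r : ℝ) (hr : 1 ≤ r)
    (Sig : Matrix (Fin m) (Fin m) ℝ)
    (hpsd : Sig.PosSemidef) (hdiag : ∀ i, Sig i i = 1)
    (hsum : 0 < ∑ i : Fin m, ∑ j : Fin m, Sig i j)
    (A : Matrix (Fin m) (Fin m) ℝ) (hA : A * A.transpose = Sig)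
    (σSig : ℝ) (hσ : σSig = Real.sqrt (∑ i : Fin m, ∑ j : Fin m, Sig i j) / m)
    (C : ℝ) (hC0 : 0 < C) (hC : C < (2 * m : ℝ) ^ (-r)) :
    gaussianVec m A {x : Fin m → ℝ | (1 / m : ℝ) * ∑ i : Fin m, Phi (-(x i)) ^ r ≤ C}
      ≤ ENNReal.ofReal (1 - Phi (-(PhiInv (C ^ (1 / r))) / σSig)) := by
  have hm0 : (0 : ℝ) < m := by exact_mod_cast hm
  have hm1 : (1 : ℝ) ≤ m := by exact_mod_cast hm
  have hr0 : 0 < r := by linarith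
  set q : ℝ := C ^ (1 / r) with hq
  have hq0 : 0 < q := Real.rpow_pos_of_pos hC0 _
  have hqr : q ^ r = C := by
    rw [hq, ← Real.rpow_mul hC0.le, one_div_mul_cancel hr0.ne', Real.rpow_one]
  have hmC : m * C < (1 / 2 : ℝ) ^ r := by
    have h1 : (2 * m : ℝ) ^ (-r) = (1 / 2 : ℝ) ^ r * ((m : ℝ) ^ r)⁻¹ := by
      rw [Real.rpow_neg (by positivity), Real.mul_rpow (by norm_num) hm0.le, mul_inv,
        one_div, Real.inv_rpow (by norm_num)]
    have h2 : (m : ℝ) ≤ (m : ℝ) ^ r := Real.self_le_rpow_of_one_le hm1 hr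
    rw [h1, ← div_eq_mul_inv, lt_div_iff₀ (by positivity)] at hC
    nlinarith
  have hq2 : q ≤ 1 / 2 := by
    rw [← Real.rpow_le_rpow_iff hq0.le (by norm_num) hr0, hqr]
    nlinarith
  have hσ0 : 0 < σSig := by rw [hσ]; positivity
  have hsub : {x : Fin m → ℝ | (1 / m : ℝ) * ∑ i : Fin m, Phi (-(x i)) ^ r ≤ C} ⊆
      {x | -PhiInv q ≤ ∑ i, (1 / m : ℝ) * x i} := by
    intro x hx
    simp only [Set.mem_ofPred_eq] at hx ⊢
    have hx' : ∑ i : Fin m, Phi (-(x i)) ^ r ≤ m * C := by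
      rwa [one_div, inv_mul_le_iff₀ hm0] at hx
    have hneg : ∀ i, -(x i) ≤ 0 := fun i => by
      have h1 : Phi (-(x i)) ^ r ≤ ∑ i : Fin m, Phi (-(x i)) ^ r :=
        Finset.single_le_sum (f := fun i => Phi (-(x i)) ^ r)
          (fun i _ => Real.rpow_nonneg (Phi_nonneg _) _) (Finset.mem_univ i)
      rw [← strictMono_Phi.le_iff_le, Phi_zero,
        ← Real.rpow_le_rpow_iff (Phi_nonneg _) (by norm_num) hr0]
      linarith
    have hJ := (convexOn_Phi_rpow hr).map_sum_le (t := Finset.univ)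
      (w := fun _ : Fin m => 1 / (m : ℝ)) (p := fun i => -(x i)) (fun _ _ => by positivity)
      (by simp [hm0.ne']) (fun i _ => hneg i)
    simp only [smul_eq_mul, ← Finset.mul_sum] at hJ
    rw [← Finset.mul_sum]
    have h2 := hJ.trans hx
    rw [← hqr, Real.rpow_le_rpow_iff (Phi_nonneg _) hq0.le hr0, ← Phi_PhiInv hq0 hq2,
      strictMono_Phi.le_iff_le, Finset.sum_neg_distrib] at h2
    linarith
  have hvar : ∑ j, (∑ i, (1 / m : ℝ) * A i j) ^ 2 = σSig ^ 2 := by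
    rw [hσ, div_pow, Real.sq_sqrt hsum.le, ← hA]
    simp only [Matrix.mul_apply, Matrix.transpose_apply, ← Finset.mul_sum, mul_pow]
    have h1 : ∀ j, (∑ i, A i j) ^ 2 = ∑ i, ∑ k, A i j * A k j := fun j => by
      rw [sq, Finset.sum_mul_sum]
    simp_rw [h1]
    rw [Finset.sum_comm]
    simp_rw [Finset.sum_comm (s := Finset.univ) (t := Finset.univ) (f := fun j k => A _ j * A k j)]
    ring
  refine (measure_mono hsub).trans (le_of_eq ?_)
  have hmap : (gaussianVec m A).map (fun x => ∑ i, (1 / m : ℝ) * x i) =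
      gaussianReal 0 (σSig ^ 2).toNNReal := by
    rw [← hvar, ← map_sum_mul_pi_gaussianReal, gaussianVec,
      Measure.map_map (by fun_prop) (by unfold Matrix.mulVec dotProduct; fun_prop)]
    congr 1
    funext z
    simp only [Function.comp, Matrix.mulVec, dotProduct, Finset.mul_sum, Finset.sum_mul]
    rw [Finset.sum_comm]
    simp only [mul_assoc]
  rw [← gaussianReal_Ici_eq hσ0, ← hmap, Measure.map_apply (by fun_prop) measurableSet_Ici]
  rfl
end

section
/- For every real r ≥ 1, the function x ↦ Φ(−x)^r is convex on [0, ∞), where Φ is the standard normal cumulative distribution function. -/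
open MeasureTheory ProbabilityTheory

/-- The upper tail of the standard normal distribution is convex on `[0,∞)`. -/
lemma convexOn_Phi_neg : ConvexOn ℝ (Set.Ici (0:ℝ)) (fun x => Phi (-x)) := by
  have hderiv (x : ℝ) : HasDerivAt (fun x => Phi (-x)) (-gaussianPDFReal 0 1 (-x)) x := by
    simpa [Function.comp_def] using (hasDerivAt_Phi (-x)).comp x (hasDerivAt_neg x)
  refine MonotoneOn.convexOn_of_deriv (convex_Ici 0)
    (fun x _ => (hderiv x).continuousAt.continuousWithinAt)
    (fun x _ => (hderiv x).differentiableAt.differentiableWithinAt) ?_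
  rw [interior_Ici]
  intro x hx y _ hxy
  have hx0 : 0 < x := hx
  rw [(hderiv x).deriv, (hderiv y).deriv, neg_le_neg_iff]
  simp only [gaussianPDFReal, sub_zero, neg_sq]
  gcongr

/-- for every `r ≥ 1`, the function `x ↦ Φ(-x)^r` is convex on `[0,∞)`. -/
theorem stmt_9 (r : ℝ) (hr : 1 ≤ r) :
    ConvexOn ℝ (Set.Ici (0:ℝ)) (fun x => Phi (-x) ^ r) := by
  have hnonneg (x : ℝ) : 0 ≤ Phi x := ENNReal.toReal_nonneg
  refine ⟨convex_Ici 0, fun x hx y hy a b ha hb hab => ?_⟩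
  exact (Real.rpow_le_rpow (hnonneg _) (convexOn_Phi_neg.2 hx hy ha hb hab) (by linarith)).trans
    ((convexOn_rpow hr).2 (hnonneg _) (hnonneg _) ha hb hab)
end
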